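/- Let B, N, e : (Fin 3 → ℝ) → (Fin 3 → ℝ) be smooth vector fields on ℝ³. Assume: div B = 0; curl N = 0 and ⟪N x, B x⟫ = 0 for all x (so N represents a closed 1-form annihilating B, a flux system); and ⟪e x, B x⟫ > 0 and ⟪curl e x, N x⟫ = 0 for all x (so e represents an adapted 1-form). Define u := fun x => (⟪e x, B x⟫)⁻¹ • ((N x) ×₃ (e x)). Then for all x: (i) (B x) ×₃ (u x) = N x; (ii) ⟪e x, u x⟫ = 0; (iii) div (fun y => ⟪e y, B y⟫ • u y) = 0; (iv) lie u (fun y => (⟪e y, B y⟫)⁻¹ • B y) x = 0; and (v) if N x ≠ 0 then u x and B x are linearly independent. -/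

import Mathlib

open Matrix
open scoped ContDiff

/-- Divergence of a vector field on `ℝ³`. -/
noncomputable def vdiv (X : (Fin 3 → ℝ) → (Fin 3 → ℝ)) (x : Fin 3 → ℝ) : ℝ :=
  ∑ i : Fin 3, fderiv ℝ X x (Pi.single i 1) i

/-- Curl of a vector field on `ℝ³`. -/
noncomputable def vcurl (X : (Fin 3 → ℝ) → (Fin 3 → ℝ)) (x : Fin 3 → ℝ) : Fin 3 → ℝ :=
  ![fderiv ℝ X x (Pi.single 1 1) 2 - fderiv ℝ X x (Pi.single 2 1) 1,
    fderiv ℝ X x (Pi.single 2 1) 0 - fderiv ℝ X x (Pi.single 0 1) 2,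
    fderiv ℝ X x (Pi.single 0 1) 1 - fderiv ℝ X x (Pi.single 1 1) 0]

/-- Lie bracket of vector fields on `ℝ³`. -/
noncomputable def vlie (X Y : (Fin 3 → ℝ) → (Fin 3 → ℝ)) (x : Fin 3 → ℝ) : Fin 3 → ℝ :=
  fderiv ℝ Y x (X x) - fderiv ℝ X x (Y x)

/-- The gradient of a scalar function on `ℝ³`. -/
noncomputable def vgrad (f : (Fin 3 → ℝ) → ℝ) (x : Fin 3 → ℝ) : Fin 3 → ℝ :=
  fun i => fderiv ℝ f x (Pi.single i 1)

section VectorCalculus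

variable {f : (Fin 3 → ℝ) → ℝ} {X Y : (Fin 3 → ℝ) → (Fin 3 → ℝ)} {x : Fin 3 → ℝ}

theorem fderiv_smul_apply_coord (hf : DifferentiableAt ℝ f x) (hX : DifferentiableAt ℝ X x)
    (v : Fin 3 → ℝ) (i : Fin 3) :
    fderiv ℝ (fun y => f y • X y) x v i = f x * fderiv ℝ X x v i + fderiv ℝ f x v * X x i := by
  rw [fderiv_fun_smul hf hX]
  simp

theorem fderiv_crossProduct_apply (hX : DifferentiableAt ℝ X x) (hY : DifferentiableAt ℝ Y x)
    (v : Fin 3 → ℝ) :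
    fderiv ℝ (fun y => X y ⨯₃ Y y) x v = X x ⨯₃ fderiv ℝ Y x v + fderiv ℝ X x v ⨯₃ Y x := by
  have hX' := hasFDerivAt_pi'.1 hX.hasFDerivAt
  have hY' := hasFDerivAt_pi'.1 hY.hasFDerivAt
  have key (i j : Fin 3) := ((hX' i).mul (hY' j)).sub ((hX' j).mul (hY' i))
  have h (i : Fin 3) : fderiv ℝ (fun y => X y ⨯₃ Y y) x v i =
      fderiv ℝ (fun y => (X y ⨯₃ Y y) i) x v := by
    rw [fderiv_apply]
    · rfl
    · refine differentiableAt_pi.2 fun i => ?_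
      fin_cases i
      · exact (key 1 2).differentiableAt
      · exact (key 2 0).differentiableAt
      · exact (key 0 1).differentiableAt
  ext i
  rw [h]
  fin_cases i
  · refine (congrArg (· v) (key 1 2).fderiv).trans ?_
    simp [cross_apply]
    ring
  · refine (congrArg (· v) (key 2 0).fderiv).trans ?_
    simp [cross_apply]
    ring
  · refine (congrArg (· v) (key 0 1).fderiv).trans ?_
    simp [cross_apply]
    ring

theorem fderiv_apply_eq_sum_coord (X : (Fin 3 → ℝ) → (Fin 3 → ℝ)) (x v : Fin 3 → ℝ) :
    fderiv ℝ X x v = ∑ i, v i • fderiv ℝ X x (Pi.single i 1) := by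
  conv_lhs => rw [pi_eq_sum_univ' v]
  simp only [map_sum, map_smul]

theorem vlie_swap (X Y : (Fin 3 → ℝ) → (Fin 3 → ℝ)) (x : Fin 3 → ℝ) :
    vlie X Y x = -vlie Y X x :=
  (neg_sub _ _).symm

theorem vdiv_smul (hf : DifferentiableAt ℝ f x) (hX : DifferentiableAt ℝ X x) :
    vdiv (fun y => f y • X y) x = f x * vdiv X x + vgrad f x ⬝ᵥ X x := by
  simp only [vdiv, fderiv_smul_apply_coord hf hX, Finset.sum_add_distrib, Finset.mul_sum,
    dotProduct, vgrad]

theorem vcurl_smul (hf : DifferentiableAt ℝ f x) (hX : DifferentiableAt ℝ X x) :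
    vcurl (fun y => f y • X y) x = f x • vcurl X x + vgrad f x ⨯₃ X x := by
  ext i
  fin_cases i <;> simp [vcurl, fderiv_smul_apply_coord hf hX, vgrad, cross_apply] <;> ring

theorem vdiv_crossProduct (hX : DifferentiableAt ℝ X x) (hY : DifferentiableAt ℝ Y x) :
    vdiv (fun y => X y ⨯₃ Y y) x = vcurl X x ⬝ᵥ Y x - vcurl Y x ⬝ᵥ X x := by
  simp only [vdiv, fderiv_crossProduct_apply hX hY]
  simp [Fin.sum_univ_three, cross_apply, vcurl, dotProduct]
  ring

theorem vcurl_crossProduct (hX : DifferentiableAt ℝ X x) (hY : DifferentiableAt ℝ Y x) :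
    vcurl (fun y => X y ⨯₃ Y y) x = vdiv Y x • X x - vdiv X x • Y x - vlie X Y x := by
  rw [vlie, fderiv_apply_eq_sum_coord Y x (X x), fderiv_apply_eq_sum_coord X x (Y x)]
  simp only [vcurl, fderiv_crossProduct_apply hX hY]
  ext i
  fin_cases i <;> simp [Fin.sum_univ_three, cross_apply, vdiv] <;> ring

end VectorCalculus

/-- For `n ⊥ b`, crossing `b` with `(e ⬝ b)⁻¹ • (n × e)` recovers `n`. -/
theorem crossProduct_inv_smul_crossProduct {b n e : Fin 3 → ℝ} (hnb : n ⬝ᵥ b = 0)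
    (heb : e ⬝ᵥ b ≠ 0) : b ⨯₃ ((e ⬝ᵥ b)⁻¹ • (n ⨯₃ e)) = n := by
  have h : b ⨯₃ (n ⨯₃ e) = (e ⬝ᵥ b) • n := by
    rw [cross_cross_eq_smul_sub_smul', hnb, dotProduct_comm b e]
    simp
  rw [map_smul, h, inv_smul_smul₀ heb]

/-- main Theorem 1, Euclidean form: given a flux system `(B, N, μ)` with an
adapted 1-form represented by `e`, the vector field `u = (⟪e,B⟫)⁻¹ • (N × e)` satisfies
`B × u = N`, `⟪e, u⟫ = 0`, `div (⟪e,B⟫ u) = 0`, `[u, B/⟪e,B⟫] = 0`, and `u x, B x` are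
linearly independent wherever `N x ≠ 0`. -/
theorem stmt_7 (B N e : (Fin 3 → ℝ) → (Fin 3 → ℝ))
    (hB : ContDiff ℝ ∞ B) (hN : ContDiff ℝ ∞ N) (he : ContDiff ℝ ∞ e)
    (hdivB : ∀ x, vdiv B x = 0)
    (hcurlN : ∀ x, vcurl N x = 0)
    (hNB : ∀ x, N x ⬝ᵥ B x = 0)
    (heB : ∀ x, 0 < e x ⬝ᵥ B x)
    (hcurle : ∀ x, vcurl e x ⬝ᵥ N x = 0) :
    ∀ x : Fin 3 → ℝ,
      (B x) ⨯₃ ((e x ⬝ᵥ B x)⁻¹ • ((N x) ⨯₃ (e x))) = N x ∧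
      e x ⬝ᵥ ((e x ⬝ᵥ B x)⁻¹ • ((N x) ⨯₃ (e x))) = 0 ∧
      vdiv (fun y => (e y ⬝ᵥ B y) • ((e y ⬝ᵥ B y)⁻¹ • ((N y) ⨯₃ (e y)))) x = 0 ∧
      vlie (fun y => (e y ⬝ᵥ B y)⁻¹ • ((N y) ⨯₃ (e y)))
        (fun y => (e y ⬝ᵥ B y)⁻¹ • B y) x = 0 ∧
      (N x ≠ 0 → LinearIndependent ℝ ![(e x ⬝ᵥ B x)⁻¹ • ((N x) ⨯₃ (e x)), B x]) := by
  intro x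
  have hρ (y) : e y ⬝ᵥ B y ≠ 0 := (heB y).ne'
  have hBu (y) := crossProduct_inv_smul_crossProduct (hNB y) (hρ y)
  have dB : Differentiable ℝ B := hB.differentiable (by simp)
  have dN : Differentiable ℝ N := hN.differentiable (by simp)
  have de : Differentiable ℝ e := he.differentiable (by simp)
  have dw : Differentiable ℝ fun y => N y ⨯₃ e y := by
    refine differentiable_pi.2 fun i => ?_
    fin_cases i <;> simp [cross_apply] <;> fun_prop
  have df : Differentiable ℝ fun y => (e y ⬝ᵥ B y)⁻¹ := by
    refine Differentiable.inv ?_ hρ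
    simp only [dotProduct]
    fun_prop
  have hdivw : vdiv (fun y => N y ⨯₃ e y) x = 0 := by
    rw [vdiv_crossProduct (dN x) (de x), hcurlN, hcurle]
    simp
  refine ⟨hBu x, ?_, ?_, ?_, fun hNx => ?_⟩
  · rw [dotProduct_smul, dot_cross_self]
    simp
  · simpa only [smul_inv_smul₀ (hρ _)] using hdivw
  · have hcurl := vcurl_crossProduct ((df.smul dB) x) ((df.smul dw) x)
    have hcross : (fun y => ((e y ⬝ᵥ B y)⁻¹ • B y) ⨯₃ ((e y ⬝ᵥ B y)⁻¹ • (N y ⨯₃ e y))) =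
        fun y => (e y ⬝ᵥ B y)⁻¹ • N y := by
      funext y
      rw [LinearMap.map_smul₂, hBu]
    have hgrad (g : Fin 3 → ℝ) : g ⨯₃ N x = (e x ⬝ᵥ B x)⁻¹ • (g ⬝ᵥ (N x ⨯₃ e x)) • B x -
        (e x ⬝ᵥ B x)⁻¹ • (g ⬝ᵥ B x) • (N x ⨯₃ e x) := by
      conv_lhs => rw [← hBu x, cross_cross_eq_smul_sub_smul', dotProduct_smul,
        dotProduct_comm (B x) g]
      module
    simp only [Pi.smul_def'] at hcurl
    rw [hcross, vcurl_smul (df x) (dN x), vdiv_smul (df x) (dB x), vdiv_smul (df x) (dw x),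
      hcurlN, hdivB, hdivw, hgrad] at hcurl
    rw [vlie_swap, neg_eq_zero]
    linear_combination (norm := module) hcurl
  · rw [LinearIndependent.pair_symm_iff, ← crossProduct_ne_zero_iff_linearIndependent, hBu]
    exact hNx
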